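/- Let H be a Hopf algebra, A a right H-comodule algebra, and γ a 2-cocycle on H. The deformed product a •_γ a' := a₍₀₎ a'₍₀₎ γ̄(a₍₁₎ ⊗ a'₍₁₎) is associative and has 1_A as unit, and the coaction δ : A → A ⊗ H is an algebra map from (A, •_γ) to (A, •_γ) ⊗ H_γ. -/

import Mathlib

open TensorProduct LinearMap

noncomputable section

variable (R H : Type*) [CommRing R] [Ring H] [HopfAlgebra R H]

/-- The multiplication of `H` as a linear map. -/
abbrev mulH : H ⊗[R] H →ₗ[R] H := LinearMap.mul' R H

/-- The antipode of `H`. -/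
abbrev Sa : H →ₗ[R] H := HopfAlgebra.antipode (R := R)

/-- The comultiplication `h ⊗ k ↦ (h₍₁₎ ⊗ k₍₁₎) ⊗ (h₍₂₎ ⊗ k₍₂₎)` on `H ⊗ H`. -/
def comul2 : H ⊗[R] H →ₗ[R] (H ⊗[R] H) ⊗[R] (H ⊗[R] H) :=
  (tensorTensorTensorComm R H H H H).toLinearMap ∘ₗ map (Coalgebra.comul (R := R)) (Coalgebra.comul (R := R))

/-- The (Coalgebra.counit (R := R)) `h ⊗ k ↦ ε(h)ε(k)` on `H ⊗ H`. -/
def counit2 : H ⊗[R] H →ₗ[R] R :=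
  (TensorProduct.lid R R).toLinearMap ∘ₗ map (Coalgebra.counit (R := R)) (Coalgebra.counit (R := R))

/-- Iterated comultiplication `h ↦ (h₍₁₎ ⊗ h₍₂₎) ⊗ h₍₃₎`. -/
def comul3 : H →ₗ[R] (H ⊗[R] H) ⊗[R] H := map (Coalgebra.comul (R := R)) LinearMap.id ∘ₗ (Coalgebra.comul (R := R))

/-- Iterated comultiplication `h ↦ ((h₍₁₎ ⊗ h₍₂₎) ⊗ h₍₃₎) ⊗ h₍₄₎`. -/
def comul4 : H →ₗ[R] ((H ⊗[R] H) ⊗[R] H) ⊗[R] H := map (comul3 R H) LinearMap.id ∘ₗ (Coalgebra.comul (R := R))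

/-- Convolution product of two functionals with respect to a given comultiplication. -/
def convOn {C : Type*} [AddCommMonoid C] [Module R C]
    (Δc : C →ₗ[R] C ⊗[R] C) (f g : C →ₗ[R] R) : C →ₗ[R] R :=
  LinearMap.mul' R R ∘ₗ map f g ∘ₗ Δc

/-- The comultiplication on the triple tensor product `(H ⊗ H) ⊗ H`. -/
def comulC3 : (H ⊗[R] H) ⊗[R] H →ₗ[R] ((H ⊗[R] H) ⊗[R] H) ⊗[R] ((H ⊗[R] H) ⊗[R] H) :=
  (tensorTensorTensorComm R (H ⊗[R] H) (H ⊗[R] H) H H).toLinearMap ∘ₗ map (comul2 R H) (Coalgebra.comul (R := R))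

/-- `γ` is a 2-cocycle with convolution inverse `γ'` relative to the product `μ`:
convolution invertible, unital, and satisfying the 2-cocycle condition
`γ(g₍₁₎⊗h₍₁₎)γ(g₍₂₎h₍₂₎⊗k) = γ(h₍₁₎⊗k₍₁₎)γ(g⊗h₍₂₎k₍₂₎)`. -/
structure IsCocycle (μ : H ⊗[R] H →ₗ[R] H) (γ γ' : H ⊗[R] H →ₗ[R] R) : Prop where
  cocycle : convOn R (comulC3 R H) (LinearMap.mul' R R ∘ₗ map γ (Coalgebra.counit (R := R))) (γ ∘ₗ map μ LinearMap.id)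
    = convOn R (comulC3 R H)
        (LinearMap.mul' R R ∘ₗ map (Coalgebra.counit (R := R)) γ ∘ₗ (TensorProduct.assoc R H H H).toLinearMap)
        (γ ∘ₗ map LinearMap.id μ ∘ₗ (TensorProduct.assoc R H H H).toLinearMap)
  conv_inv_right : convOn R (comul2 R H) γ γ' = counit2 R H
  conv_inv_left : convOn R (comul2 R H) γ' γ = counit2 R H
  unital_right : ∀ h : H, γ (h ⊗ₜ[R] 1) = (Coalgebra.counit (R := R)) h
  unital_left : ∀ h : H, γ (1 ⊗ₜ[R] h) = (Coalgebra.counit (R := R)) h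

/-- The twisted product `h ·_γ k = γ(h₍₁₎⊗k₍₁₎) h₍₂₎∙k₍₂₎ γ'(h₍₃₎⊗k₍₃₎)`, where `∙` is
the (possibly already deformed) product `μ`. -/
def twistMul (μ : H ⊗[R] H →ₗ[R] H) (γ γ' : H ⊗[R] H →ₗ[R] R) : H ⊗[R] H →ₗ[R] H :=
  (TensorProduct.lid R H).toLinearMap ∘ₗ (TensorProduct.rid R (R ⊗[R] H)).toLinearMap
    ∘ₗ map (map γ μ) γ' ∘ₗ map (comul2 R H) LinearMap.id ∘ₗ comul2 R H

/-- `u_γ(h) = γ(h₍₁₎ ⊗ S(h₍₂₎))`. -/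
def uMap (γ : H ⊗[R] H →ₗ[R] R) : H →ₗ[R] R :=
  γ ∘ₗ map LinearMap.id (Sa R H) ∘ₗ (Coalgebra.comul (R := R))

/-- `ū_γ(h) = γ'(S(h₍₁₎) ⊗ h₍₂₎)`. -/
def ubarMap (γ' : H ⊗[R] H →ₗ[R] R) : H →ₗ[R] R :=
  γ' ∘ₗ map (Sa R H) LinearMap.id ∘ₗ (Coalgebra.comul (R := R))

/-- The twisted antipode `S_γ(h) = u_γ(h₍₁₎) S(h₍₂₎) ū_γ(h₍₃₎)`. -/
def Stw (γ γ' : H ⊗[R] H →ₗ[R] R) : H →ₗ[R] H :=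
  (TensorProduct.lid R H).toLinearMap ∘ₗ (TensorProduct.rid R (R ⊗[R] H)).toLinearMap
    ∘ₗ map (map (uMap R H γ) (Sa R H)) (ubarMap R H γ') ∘ₗ comul3 R H

/-- The (generalized) right adjoint coaction `h ↦ h₍₂₎ ⊗ S'(h₍₁₎) ∙ h₍₃₎`. -/
def AdGen (S' : H →ₗ[R] H) (μ : H ⊗[R] H →ₗ[R] H) : H →ₗ[R] H ⊗[R] H :=
  map LinearMap.id μ ∘ₗ (TensorProduct.assoc R H H H).toLinearMap
    ∘ₗ map ((TensorProduct.comm R H H).toLinearMap ∘ₗ map S' LinearMap.id) LinearMap.id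
    ∘ₗ comul3 R H

/-- The right adjoint coaction `Ad(h) = h₍₂₎ ⊗ S(h₍₁₎)h₍₃₎`. -/
def Ad : H →ₗ[R] H ⊗[R] H := AdGen R H (Sa R H) (mulH R H)

end

noncomputable section

open TensorProduct LinearMap

variable (R H A : Type*) [CommRing R] [Ring H] [HopfAlgebra R H]
  [Ring A] [Algebra R A]

/-- The diagonal `H`-coaction on `A ⊗ A`: `a ⊗ a' ↦ a₍₀₎ ⊗ a'₍₀₎ ⊗ a₍₁₎a'₍₁₎`. -/
def coactAA (δ : A →ₗ[R] A ⊗[R] H) : A ⊗[R] A →ₗ[R] (A ⊗[R] A) ⊗[R] H :=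
  map LinearMap.id (mulH R H) ∘ₗ (tensorTensorTensorComm R A H A H).toLinearMap ∘ₗ map δ δ

/-- The canonical map `a ⊗ a' ↦ a ∙ a'₍₀₎ ⊗ a'₍₁₎` (with respect to a product `μA` on `A`). -/
def chiMap (μA : A ⊗[R] A →ₗ[R] A) (δ : A →ₗ[R] A ⊗[R] H) : A ⊗[R] A →ₗ[R] A ⊗[R] H :=
  map μA LinearMap.id ∘ₗ (TensorProduct.assoc R A A H).symm.toLinearMap ∘ₗ map LinearMap.id δ

/-- The `H`-coaction on `A ⊗ H̲`: `a ⊗ h ↦ a₍₀₎ ⊗ h₍₂₎ ⊗ a₍₁₎ S(h₍₁₎) h₍₃₎`. -/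
def coactAH (δ : A →ₗ[R] A ⊗[R] H) : A ⊗[R] H →ₗ[R] (A ⊗[R] H) ⊗[R] H :=
  map LinearMap.id (mulH R H) ∘ₗ (tensorTensorTensorComm R A H H H).toLinearMap ∘ₗ map δ (Ad R H)

/-- `δ` is a coassociative counital coaction. -/
def IsCoaction {V : Type*} [AddCommGroup V] [Module R V] (δ : V →ₗ[R] V ⊗[R] H) : Prop :=
  ((TensorProduct.assoc R V H H).toLinearMap ∘ₗ map δ LinearMap.id ∘ₗ δ
      = map LinearMap.id (Coalgebra.comul (R := R)) ∘ₗ δ) ∧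
  ((TensorProduct.rid R V).toLinearMap ∘ₗ map LinearMap.id (Coalgebra.counit (R := R)) ∘ₗ δ
      = LinearMap.id)

/-- `δ` makes `A` a right `H`-comodule algebra. -/
def IsComodAlg (δ : A →ₗ[R] A ⊗[R] H) : Prop :=
  IsCoaction R H δ ∧ (∀ a b : A, δ (a * b) = δ a * δ b) ∧ δ 1 = 1

/-- The twist-deformed product `a •_γ a' = a₍₀₎ a'₍₀₎ γ'(a₍₁₎ ⊗ a'₍₁₎)` on `A`. -/
def mulAg (δ : A →ₗ[R] A ⊗[R] H) (γ' : H ⊗[R] H →ₗ[R] R) : A ⊗[R] A →ₗ[R] A :=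
  (TensorProduct.rid R A).toLinearMap ∘ₗ map (LinearMap.mul' R A) γ'
    ∘ₗ (tensorTensorTensorComm R A H A H).toLinearMap ∘ₗ map δ δ

end


open TensorProduct LinearMap Coalgebra WithConv

noncomputable section

namespace RightCoaction

section General

variable {R M N C D B : Type*} [CommRing R] [AddCommGroup M] [Module R M] [AddCommGroup N]
  [Module R N] [AddCommGroup C] [Module R C] [AddCommGroup D] [Module R D] [Ring B] [Algebra R B]

/-- Coassociativity of a right coaction of a coalgebra. -/
def IsCoassoc [Coalgebra R C] (δ : M →ₗ[R] M ⊗[R] C) : Prop :=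
  (TensorProduct.assoc R M C C).toLinearMap ∘ₗ map δ LinearMap.id ∘ₗ δ
    = map LinearMap.id (comul (R := R)) ∘ₗ δ

/-- Counitality of a right coaction of a coalgebra. -/
def IsCounital [Coalgebra R C] (δ : M →ₗ[R] M ⊗[R] C) : Prop :=
  (TensorProduct.rid R M).toLinearMap ∘ₗ map LinearMap.id (counit (R := R)) ∘ₗ δ = LinearMap.id

/-- The codiagonal coaction of `C ⊗ D` on `M ⊗ N`. -/
def tensor (δ : M →ₗ[R] M ⊗[R] C) (δ' : N →ₗ[R] N ⊗[R] D) :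
    M ⊗[R] N →ₗ[R] (M ⊗[R] N) ⊗[R] (C ⊗[R] D) :=
  (tensorTensorTensorComm R M C N D).toLinearMap ∘ₗ map δ δ'

/-- The action `m ↦ f(m₍₁₎) m₍₀₎` of a functional `f` on a comodule. -/
def act (δ : M →ₗ[R] M ⊗[R] C) (f : C →ₗ[R] R) : M →ₗ[R] M :=
  (TensorProduct.rid R M).toLinearMap ∘ₗ map LinearMap.id f ∘ₗ δ

lemma IsCoassoc.tensor [Coalgebra R C] [Coalgebra R D] {δ : M →ₗ[R] M ⊗[R] C} {δ' : N →ₗ[R] N ⊗[R] D}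
    (h : IsCoassoc δ) (h' : IsCoassoc δ') : IsCoassoc (tensor δ δ') := by
  let F : (M ⊗[R] (C ⊗[R] C)) ⊗[R] (N ⊗[R] (D ⊗[R] D)) →ₗ[R]
      (M ⊗[R] N) ⊗[R] ((C ⊗[R] D) ⊗[R] (C ⊗[R] D)) :=
    map LinearMap.id (tensorTensorTensorComm R C C D D).toLinearMap ∘ₗ
      (tensorTensorTensorComm R M (C ⊗[R] C) N (D ⊗[R] D)).toLinearMap
  have e : (TensorProduct.assoc R (M ⊗[R] N) (C ⊗[R] D) (C ⊗[R] D)).toLinearMap ∘ₗ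
      map (tensorTensorTensorComm R M C N D).toLinearMap LinearMap.id ∘ₗ
      (tensorTensorTensorComm R (M ⊗[R] C) C (N ⊗[R] D) D).toLinearMap =
      F ∘ₗ map (TensorProduct.assoc R M C C).toLinearMap
        (TensorProduct.assoc R N D D).toLinearMap := by
    ext; simp [F]
  ext m n
  have hm := congr($h m)
  have hn := congr($h' n)
  simp only [LinearMap.comp_apply] at hm hn
  have l : ∀ (x : M ⊗[R] C) (y : N ⊗[R] D),
      map (RightCoaction.tensor δ δ') LinearMap.id (tensorTensorTensorComm R M C N D (x ⊗ₜ y)) =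
      map (tensorTensorTensorComm R M C N D).toLinearMap LinearMap.id
        (tensorTensorTensorComm R (M ⊗[R] C) C (N ⊗[R] D) D
          (map δ LinearMap.id x ⊗ₜ map δ' LinearMap.id y)) := by
    have : map (RightCoaction.tensor δ δ') LinearMap.id ∘ₗ
        (tensorTensorTensorComm R M C N D).toLinearMap =
      map (tensorTensorTensorComm R M C N D).toLinearMap LinearMap.id ∘ₗ
        (tensorTensorTensorComm R (M ⊗[R] C) C (N ⊗[R] D) D).toLinearMap ∘ₗ
          map (map δ LinearMap.id) (map δ' LinearMap.id) := by
      ext; simp [RightCoaction.tensor]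
    intro x y
    exact congr($this (x ⊗ₜ y))
  have r : ∀ (x : M ⊗[R] C) (y : N ⊗[R] D),
      map LinearMap.id (comul (R := R)) (tensorTensorTensorComm R M C N D (x ⊗ₜ y)) =
      F (map LinearMap.id (comul (R := R)) x ⊗ₜ map LinearMap.id (comul (R := R)) y) := by
    have : map LinearMap.id (comul (R := R)) ∘ₗ (tensorTensorTensorComm R M C N D).toLinearMap =
        F ∘ₗ map (map LinearMap.id (comul (R := R))) (map LinearMap.id (comul (R := R))) := by
      ext
      simp [F, AlgebraTensorModule.tensorTensorTensorComm_eq]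
    intro x y
    exact congr($this (x ⊗ₜ y))
  have e' := congr($e (map δ LinearMap.id (δ m) ⊗ₜ map δ' LinearMap.id (δ' n)))
  simp only [LinearMap.comp_apply, map_tmul, LinearEquiv.coe_coe] at e' hm hn
  rw [hm, hn] at e'
  simp only [AlgebraTensorModule.curry_apply, curry_apply, LinearMap.restrictScalars_apply,
    LinearMap.comp_apply, LinearEquiv.coe_coe]
  conv_lhs =>
    enter [2, 2]
    simp only [RightCoaction.tensor, LinearMap.comp_apply, map_tmul, LinearEquiv.coe_coe]
  conv_rhs =>
    enter [2]
    simp only [RightCoaction.tensor, LinearMap.comp_apply, map_tmul, LinearEquiv.coe_coe]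
  rw [l, r, e']

lemma map_comp_act [Coalgebra R C] {δ : M →ₗ[R] M ⊗[R] C} (h : IsCoassoc δ) (g : C →ₗ[R] B) (f : C →ₗ[R] R) :
    map LinearMap.id g ∘ₗ δ ∘ₗ act δ f =
      map LinearMap.id (toConv g * toConv (Algebra.linearMap R B ∘ₗ f)).ofConv ∘ₗ δ := by
  have e : (TensorProduct.rid R (M ⊗[R] B)).toLinearMap ∘ₗ map (map LinearMap.id g) f =
      map LinearMap.id (mul' R B ∘ₗ map g (Algebra.linearMap R B ∘ₗ f)) ∘ₗ
        (TensorProduct.assoc R M C C).toLinearMap := by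
    ext m c d
    simp [Algebra.algebraMap_eq_smul_one]
  have e' : map LinearMap.id g ∘ₗ δ ∘ₗ act δ f =
      ((TensorProduct.rid R (M ⊗[R] B)).toLinearMap ∘ₗ map (map LinearMap.id g) f) ∘ₗ
        map δ LinearMap.id ∘ₗ δ := by
    have : map LinearMap.id g ∘ₗ δ ∘ₗ (TensorProduct.rid R M).toLinearMap ∘ₗ map LinearMap.id f =
      ((TensorProduct.rid R (M ⊗[R] B)).toLinearMap ∘ₗ map (map LinearMap.id g) f) ∘ₗ
        map δ LinearMap.id := by ext; simp
    ext m
    exact congr($this (δ m))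
  rw [e', e, comp_assoc, h, ← comp_assoc, ← map_comp, LinearMap.id_comp]
  rfl

lemma map_act_comp [Coalgebra R C] {δ : M →ₗ[R] M ⊗[R] C} (h : IsCoassoc δ) (f : C →ₗ[R] R) (g : C →ₗ[R] B) :
    map (act δ f) g ∘ₗ δ =
      map LinearMap.id (toConv (Algebra.linearMap R B ∘ₗ f) * toConv g).ofConv ∘ₗ δ := by
  have e : map ((TensorProduct.rid R M).toLinearMap ∘ₗ map LinearMap.id f) g =
      map LinearMap.id (mul' R B ∘ₗ map (Algebra.linearMap R B ∘ₗ f) g) ∘ₗ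
        (TensorProduct.assoc R M C C).toLinearMap := by
    ext m c d
    simp [Algebra.algebraMap_eq_smul_one, smul_tmul]
  have e' : map (act δ f) g ∘ₗ δ =
      map ((TensorProduct.rid R M).toLinearMap ∘ₗ map LinearMap.id f) g ∘ₗ
        map δ LinearMap.id ∘ₗ δ := by
    rw [← comp_assoc, ← map_comp, LinearMap.comp_id]
    rfl
  rw [e', e, comp_assoc, h, ← comp_assoc, ← map_comp, LinearMap.id_comp]
  rfl

lemma act_comp_act [Coalgebra R C] {δ : M →ₗ[R] M ⊗[R] C} (h : IsCoassoc δ) (g f : C →ₗ[R] R) :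
    act δ g ∘ₗ act δ f = act δ (toConv g * toConv f).ofConv :=
  congr((TensorProduct.rid R M).toLinearMap ∘ₗ $(map_comp_act h g f))

lemma act_comp_of_comp_eq {δ : M →ₗ[R] M ⊗[R] C} {δ' : N →ₗ[R] N ⊗[R] D} {φ : M →ₗ[R] N}
    {ψ : C →ₗ[R] D} (h : δ' ∘ₗ φ = map φ ψ ∘ₗ δ) (f : D →ₗ[R] R) :
    act δ' f ∘ₗ φ = φ ∘ₗ act δ (f ∘ₗ ψ) := by
  have : ((TensorProduct.rid R N).toLinearMap ∘ₗ map LinearMap.id f) ∘ₗ map φ ψ =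
      φ ∘ₗ (TensorProduct.rid R M).toLinearMap ∘ₗ map LinearMap.id (f ∘ₗ ψ) := by
    ext; simp
  calc act δ' f ∘ₗ φ = ((TensorProduct.rid R N).toLinearMap ∘ₗ map LinearMap.id f) ∘ₗ δ' ∘ₗ φ := rfl
    _ = _ := by rw [h, ← comp_assoc, this]; rfl

lemma map_act_id [Coalgebra R D] (δ : M →ₗ[R] M ⊗[R] C) {δ' : N →ₗ[R] N ⊗[R] D} (h : IsCounital δ')
    (f : C →ₗ[R] R) :
    map (act δ f) LinearMap.id =
      act (tensor δ δ') (mul' R R ∘ₗ map f (counit (R := R))) := by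
  have e : map ((TensorProduct.rid R M).toLinearMap ∘ₗ map LinearMap.id f)
        ((TensorProduct.rid R N).toLinearMap ∘ₗ map LinearMap.id (counit (R := R))) =
      (TensorProduct.rid R (M ⊗[R] N)).toLinearMap ∘ₗ
        map LinearMap.id (mul' R R ∘ₗ map f (counit (R := R) (A := D))) ∘ₗ
          (tensorTensorTensorComm R M C N D).toLinearMap := by
    ext; simp [smul_tmul', smul_smul, mul_comm]
  rw [← h]
  ext m n
  exact congr($e (δ m ⊗ₜ δ' n))

lemma map_id_act [Coalgebra R C] {δ : M →ₗ[R] M ⊗[R] C} (h : IsCounital δ) (δ' : N →ₗ[R] N ⊗[R] D)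
    (f : D →ₗ[R] R) :
    map LinearMap.id (act δ' f) =
      act (tensor δ δ') (mul' R R ∘ₗ map (counit (R := R)) f) := by
  have e : map ((TensorProduct.rid R M).toLinearMap ∘ₗ map LinearMap.id (counit (R := R)))
        ((TensorProduct.rid R N).toLinearMap ∘ₗ map LinearMap.id f) =
      (TensorProduct.rid R (M ⊗[R] N)).toLinearMap ∘ₗ
        map LinearMap.id (mul' R R ∘ₗ map (counit (R := R) (A := C)) f) ∘ₗ
          (tensorTensorTensorComm R M C N D).toLinearMap := by
    ext; simp [smul_tmul', smul_smul, mul_comm]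
  rw [← h]
  ext m n
  exact congr($e (δ m ⊗ₜ δ' n))

end General

end RightCoaction

section Cocycle

variable {R H : Type*} [CommRing R] [Ring H] [HopfAlgebra R H]

lemma counit2_eq_counit : counit2 R H = counit (R := R) := by
  ext; simp [counit2, mul_comm]

lemma toConv_comp_mul_toConv_comp {C D : Type*} [AddCommGroup C] [Module R C] [Coalgebra R C]
    [AddCommGroup D] [Module R D] [Coalgebra R D] {f g : D →ₗ[R] R}
    (h : toConv f * toConv g = 1) (φ : C →ₗc[R] D) :
    toConv (f ∘ₗ φ.toLinearMap) * toConv (g ∘ₗ φ.toLinearMap) = 1 := by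
  have e := convMul_comp_coalgHom_distrib (toConv f) (toConv g) φ
  rw [h] at e
  apply ofConv_injective
  rw [← e]
  ext
  simp

variable {γ γ' : H ⊗[R] H →ₗ[R] R}

lemma IsCocycle.mul_inv {μ : H ⊗[R] H →ₗ[R] H} (h : IsCocycle R H μ γ γ') :
    toConv γ * toConv γ' = 1 := by
  apply ofConv_injective
  exact h.conv_inv_right.trans counit2_eq_counit

lemma IsCocycle.inv_mul {μ : H ⊗[R] H →ₗ[R] H} (h : IsCocycle R H μ γ γ') :
    toConv γ' * toConv γ = 1 := by
  apply ofConv_injective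
  exact h.conv_inv_left.trans counit2_eq_counit

/-- The inverse cocycle condition
`γ'(g₍₁₎h₍₁₎⊗k₍₁₎)γ'(g₍₂₎⊗h₍₂₎)ε(k₍₂₎) = γ'(g₍₁₎⊗h₍₁₎k₍₁₎)ε(g₍₂₎)γ'(h₍₂₎⊗k₍₂₎)`. -/
lemma IsCocycle.inv_cocycle (h : IsCocycle R H (mulH R H) γ γ') :
    toConv (γ' ∘ₗ map (mulH R H) LinearMap.id) *
        toConv (mul' R R ∘ₗ map γ' (counit (R := R))) =
      toConv (γ' ∘ₗ map LinearMap.id (mulH R H) ∘ₗ (TensorProduct.assoc R H H H).toLinearMap) *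
        toConv (mul' R R ∘ₗ map (counit (R := R)) γ' ∘ₗ
          (TensorProduct.assoc R H H H).toLinearMap) := by
  have hc : toConv (mul' R R ∘ₗ map γ (counit (R := R))) *
        toConv (γ ∘ₗ map (mulH R H) LinearMap.id) =
      toConv (mul' R R ∘ₗ map (counit (R := R)) γ ∘ₗ
          (TensorProduct.assoc R H H H).toLinearMap) *
        toConv (γ ∘ₗ map LinearMap.id (mulH R H) ∘ₗ
          (TensorProduct.assoc R H H H).toLinearMap) :=
    ofConv_injective h.cocycle
  let assocHom : (H ⊗[R] H) ⊗[R] H →ₗc[R] H ⊗[R] (H ⊗[R] H) :=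
    (Coalgebra.TensorProduct.assoc R R H H H).toCoalgHom
  let mulLeft : (H ⊗[R] H) ⊗[R] H →ₗc[R] H ⊗[R] H :=
    Coalgebra.TensorProduct.map (Bialgebra.mulCoalgHom R H) (CoalgHom.id R H)
  let mulRight : (H ⊗[R] H) ⊗[R] H →ₗc[R] H ⊗[R] H :=
    (Coalgebra.TensorProduct.map (CoalgHom.id R H) (Bialgebra.mulCoalgHom R H)).comp assocHom
  let projLeft : (H ⊗[R] H) ⊗[R] H →ₗc[R] H ⊗[R] H :=
    (Coalgebra.TensorProduct.rid R R (H ⊗[R] H)).toCoalgHom.comp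
      (Coalgebra.TensorProduct.map (CoalgHom.id R (H ⊗[R] H)) (Coalgebra.counitCoalgHom R H))
  let projRight : (H ⊗[R] H) ⊗[R] H →ₗc[R] H ⊗[R] H :=
    ((Coalgebra.TensorProduct.lid R (H ⊗[R] H)).toCoalgHom.comp
      (Coalgebra.TensorProduct.map (Coalgebra.counitCoalgHom R H)
        (CoalgHom.id R (H ⊗[R] H)))).comp assocHom
  have hl (f : H ⊗[R] H →ₗ[R] R) :
      mul' R R ∘ₗ map f (counit (R := R)) = f ∘ₗ projLeft.toLinearMap := by
    ext; simp [projLeft, mul_comm]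
  have hr (f : H ⊗[R] H →ₗ[R] R) :
      mul' R R ∘ₗ map (counit (R := R)) f ∘ₗ (TensorProduct.assoc R H H H).toLinearMap =
        f ∘ₗ projRight.toLinearMap := by
    ext; simp [projRight, assocHom]
  have hml (f : H ⊗[R] H →ₗ[R] R) :
      f ∘ₗ map (mulH R H) LinearMap.id = f ∘ₗ mulLeft.toLinearMap := rfl
  have hmr (f : H ⊗[R] H →ₗ[R] R) :
      f ∘ₗ map LinearMap.id (mulH R H) ∘ₗ (TensorProduct.assoc R H H H).toLinearMap =
        f ∘ₗ mulRight.toLinearMap := rfl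
  rw [hl, hr, hml, hmr] at hc ⊢
  refine left_inv_eq_right_inv
    (a := toConv (γ ∘ₗ projLeft.toLinearMap) * toConv (γ ∘ₗ mulLeft.toLinearMap)) ?_ ?_
  · rw [mul_assoc, ← mul_assoc _ (toConv (γ ∘ₗ projLeft.toLinearMap)),
      toConv_comp_mul_toConv_comp h.inv_mul, one_mul, toConv_comp_mul_toConv_comp h.inv_mul]
  · rw [hc, mul_assoc, ← mul_assoc _ (toConv (γ' ∘ₗ mulRight.toLinearMap)),
      toConv_comp_mul_toConv_comp h.mul_inv, one_mul, toConv_comp_mul_toConv_comp h.mul_inv]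

lemma IsCocycle.inv_unital_right {μ : H ⊗[R] H →ₗ[R] H} (h : IsCocycle R H μ γ γ') (x : H) :
    γ' (x ⊗ₜ 1) = counit (R := R) x := by
  let ι : H →ₗc[R] H ⊗[R] H :=
    (Coalgebra.TensorProduct.map (CoalgHom.id R H) (Bialgebra.unitBialgHom R H).toCoalgHom).comp
      (Coalgebra.TensorProduct.rid R R H).symm.toCoalgHom
  have hι (f : H ⊗[R] H →ₗ[R] R) (y : H) : (f ∘ₗ ι.toLinearMap) y = f (y ⊗ₜ 1) := by
    have h1 : (Bialgebra.unitBialgHom R H).toCoalgHom 1 = 1 := map_one (Bialgebra.unitBialgHom R H)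
    simp [ι, h1]
  have e : toConv (γ ∘ₗ ι.toLinearMap) = 1 := by
    ext y
    exact (hι γ y).trans (h.unital_right y)
  have e' := toConv_comp_mul_toConv_comp h.mul_inv ι
  rw [e, one_mul] at e'
  exact (hι γ' x).symm.trans congr(ofConv $e' x)

lemma IsCocycle.inv_unital_left {μ : H ⊗[R] H →ₗ[R] H} (h : IsCocycle R H μ γ γ') (x : H) :
    γ' (1 ⊗ₜ x) = counit (R := R) x := by
  let ι : H →ₗc[R] H ⊗[R] H :=
    (Coalgebra.TensorProduct.map (Bialgebra.unitBialgHom R H).toCoalgHom (CoalgHom.id R H)).comp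
      (Coalgebra.TensorProduct.lid R H).symm.toCoalgHom
  have hι (f : H ⊗[R] H →ₗ[R] R) (y : H) : (f ∘ₗ ι.toLinearMap) y = f (1 ⊗ₜ y) := by
    have h1 : (Bialgebra.unitBialgHom R H).toCoalgHom 1 = 1 := map_one (Bialgebra.unitBialgHom R H)
    simp [ι, h1]
  have e : toConv (γ ∘ₗ ι.toLinearMap) = 1 := by
    ext y
    exact (hι γ y).trans (h.unital_left y)
  have e' := toConv_comp_mul_toConv_comp h.mul_inv ι
  rw [e, one_mul] at e'
  exact (hι γ' x).symm.trans congr(ofConv $e' x)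

lemma twistMul_eq_conv (μ : H ⊗[R] H →ₗ[R] H) (γ γ' : H ⊗[R] H →ₗ[R] R) :
    twistMul R H μ γ γ' = (toConv (Algebra.linearMap R H ∘ₗ γ) * toConv μ *
      toConv (Algebra.linearMap R H ∘ₗ γ')).ofConv := by
  have e : (TensorProduct.lid R H).toLinearMap ∘ₗ (TensorProduct.rid R (R ⊗[R] H)).toLinearMap
      ∘ₗ map (map γ μ) γ' =
      mul' R H ∘ₗ map (mul' R H ∘ₗ map (Algebra.linearMap R H ∘ₗ γ) μ)
        (Algebra.linearMap R H ∘ₗ γ') := by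
    ext
    simp [Algebra.algebraMap_eq_smul_one]
  ext x y
  have := congr($e (map (comul2 R H) LinearMap.id (comul2 R H (x ⊗ₜ y))))
  refine this.trans ?_
  simp only [LinearMap.comp_apply]
  rw [← LinearMap.comp_apply (map _ _) (map _ _), ← map_comp]
  rfl

end Cocycle

section ComoduleAlgebra

open RightCoaction

variable {R H A : Type*} [CommRing R] [Ring H] [HopfAlgebra R H] [Ring A] [Algebra R A]
  {δ : A →ₗ[R] A ⊗[R] H}

lemma mulAg_eq_mul_comp_act (δ : A →ₗ[R] A ⊗[R] H) (γ' : H ⊗[R] H →ₗ[R] R) :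
    mulAg R H A δ γ' = mul' R A ∘ₗ act (tensor δ δ) γ' := by
  have e : (TensorProduct.rid R A).toLinearMap ∘ₗ map (mul' R A) γ' =
      mul' R A ∘ₗ (TensorProduct.rid R (A ⊗[R] A)).toLinearMap ∘ₗ map LinearMap.id γ' := by
    ext; simp
  ext a b
  exact congr($e (tensor δ δ (a ⊗ₜ b)))

lemma IsComodAlg.isCoassoc (h : IsComodAlg R H A δ) : IsCoassoc δ := h.1.1

lemma IsComodAlg.isCounital (h : IsComodAlg R H A δ) : IsCounital δ := h.1.2

lemma IsComodAlg.comp_mul (h : IsComodAlg R H A δ) :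
    δ ∘ₗ mul' R A = map (mul' R A) (mulH R H) ∘ₗ tensor δ δ := by
  have e : mul' R (A ⊗[R] H) =
      map (mul' R A) (mulH R H) ∘ₗ (tensorTensorTensorComm R A H A H).toLinearMap := by
    ext; simp
  ext a b
  exact (h.2.1 a b).trans congr($e (δ a ⊗ₜ δ b))

end ComoduleAlgebra

end


open RightCoaction in
/-- the deformed product `a •_γ a' = a₍₀₎a'₍₀₎ γ̄(a₍₁₎⊗a'₍₁₎)` on a right
`H`-comodule algebra `A` is associative with unit `1`, and the coaction is an algebra map
from `(A, •_γ)` to `(A, •_γ) ⊗ H_γ`. -/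
theorem mulAg_comodule_algebra (R H A : Type*) [CommRing R] [Ring H] [HopfAlgebra R H]
    [Ring A] [Algebra R A] (δ : A →ₗ[R] A ⊗[R] H) (hδ : IsComodAlg R H A δ)
    (γ γ' : H ⊗[R] H →ₗ[R] R) (hco : IsCocycle R H (mulH R H) γ γ') :
    (mulAg R H A δ γ' ∘ₗ map (mulAg R H A δ γ') LinearMap.id
        = mulAg R H A δ γ' ∘ₗ map LinearMap.id (mulAg R H A δ γ')
          ∘ₗ (TensorProduct.assoc R A A A).toLinearMap)
    ∧ (∀ a : A, mulAg R H A δ γ' (a ⊗ₜ[R] 1) = a)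
    ∧ (∀ a : A, mulAg R H A δ γ' ((1 : A) ⊗ₜ[R] a) = a)
    ∧ (δ ∘ₗ mulAg R H A δ γ'
        = map (mulAg R H A δ γ') (twistMul R H (mulH R H) γ γ')
          ∘ₗ (tensorTensorTensorComm R A H A H).toLinearMap ∘ₗ map δ δ) := by
  have hγ := hδ.isCoassoc.tensor hδ.isCoassoc
  have hγ3 := hγ.tensor hδ.isCoassoc
  refine ⟨?_, fun a ↦ ?_, fun a ↦ ?_, ?_⟩
  · have hl : tensor δ δ ∘ₗ map (mul' R A) LinearMap.id =
        map (map (mul' R A) LinearMap.id) (map (mulH R H) LinearMap.id) ∘ₗ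
          tensor (tensor δ δ) δ := by
      have e : (tensorTensorTensorComm R A H A H).toLinearMap ∘ₗ
            map (map (mul' R A) (mulH R H)) LinearMap.id =
          map (map (mul' R A) LinearMap.id) (map (mulH R H) LinearMap.id) ∘ₗ
            (tensorTensorTensorComm R (A ⊗[R] A) (H ⊗[R] H) A H).toLinearMap := by
        ext; simp
      ext a b c
      refine .trans ?_ congr($e (tensor δ δ (a ⊗ₜ b) ⊗ₜ δ c))
      exact congr(tensorTensorTensorComm R A H A H ($hδ.comp_mul (a ⊗ₜ b) ⊗ₜ δ c))
    have hr : tensor δ δ ∘ₗ map LinearMap.id (mul' R A) =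
        map (map LinearMap.id (mul' R A)) (map LinearMap.id (mulH R H)) ∘ₗ
          tensor δ (tensor δ δ) := by
      have e : (tensorTensorTensorComm R A H A H).toLinearMap ∘ₗ
            map LinearMap.id (map (mul' R A) (mulH R H)) =
          map (map LinearMap.id (mul' R A)) (map LinearMap.id (mulH R H)) ∘ₗ
            (tensorTensorTensorComm R A H (A ⊗[R] A) (H ⊗[R] H)).toLinearMap := by
        ext; simp
      ext a b c
      refine .trans ?_ congr($e (δ a ⊗ₜ tensor δ δ (b ⊗ₜ c)))
      exact congr(tensorTensorTensorComm R A H A H (δ a ⊗ₜ $hδ.comp_mul (b ⊗ₜ c)))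
    have ha : tensor δ (tensor δ δ) ∘ₗ (TensorProduct.assoc R A A A).toLinearMap =
        map (TensorProduct.assoc R A A A).toLinearMap
          (TensorProduct.assoc R H H H).toLinearMap ∘ₗ tensor (tensor δ δ) δ := by
      have e : (tensorTensorTensorComm R A H (A ⊗[R] A) (H ⊗[R] H)).toLinearMap ∘ₗ
            map LinearMap.id (tensorTensorTensorComm R A H A H).toLinearMap ∘ₗ
              (TensorProduct.assoc R (A ⊗[R] H) (A ⊗[R] H) (A ⊗[R] H)).toLinearMap =
          map (TensorProduct.assoc R A A A).toLinearMap
              (TensorProduct.assoc R H H H).toLinearMap ∘ₗ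
            (tensorTensorTensorComm R (A ⊗[R] A) (H ⊗[R] H) A H).toLinearMap ∘ₗ
              map (tensorTensorTensorComm R A H A H).toLinearMap LinearMap.id := by
        ext; simp
      ext a b c
      exact congr($e ((δ a ⊗ₜ δ b) ⊗ₜ δ c))
    have hm : mul' R A ∘ₗ map (mul' R A) LinearMap.id =
        mul' R A ∘ₗ map LinearMap.id (mul' R A) ∘ₗ
          (TensorProduct.assoc R A A A).toLinearMap := by
      ext; simp [mul_assoc]
    calc mulAg R H A δ γ' ∘ₗ map (mulAg R H A δ γ') LinearMap.id
      _ = mul' R A ∘ₗ (act (tensor δ δ) γ' ∘ₗ map (mul' R A) LinearMap.id) ∘ₗ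
            map (act (tensor δ δ) γ') LinearMap.id := by
        rw [mulAg_eq_mul_comp_act, comp_assoc, comp_assoc, ← map_comp, LinearMap.id_comp]
      _ = (mul' R A ∘ₗ map (mul' R A) LinearMap.id) ∘ₗ act (tensor (tensor δ δ) δ)
            (toConv (γ' ∘ₗ map (mulH R H) LinearMap.id) *
              toConv (mul' R R ∘ₗ map γ' (counit (R := R)))).ofConv := by
        rw [act_comp_of_comp_eq hl, map_act_id _ hδ.isCounital, comp_assoc, act_comp_act hγ3,
          comp_assoc]
      _ = mul' R A ∘ₗ map LinearMap.id (mul' R A) ∘ₗ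
            (TensorProduct.assoc R A A A).toLinearMap ∘ₗ
            act (tensor (tensor δ δ) δ) ((γ' ∘ₗ map LinearMap.id (mulH R H)) ∘ₗ
              (TensorProduct.assoc R H H H).toLinearMap) ∘ₗ
            act (tensor (tensor δ δ) δ) ((mul' R R ∘ₗ map (counit (R := R)) γ') ∘ₗ
              (TensorProduct.assoc R H H H).toLinearMap) := by
        rw [hm, hco.inv_cocycle, act_comp_act hγ3]
        rfl
      _ = mul' R A ∘ₗ (act (tensor δ δ) γ' ∘ₗ map LinearMap.id (mul' R A)) ∘ₗ
            map LinearMap.id (act (tensor δ δ) γ') ∘ₗ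
              (TensorProduct.assoc R A A A).toLinearMap := by
        rw [act_comp_of_comp_eq hr, map_id_act hδ.isCounital, act_comp_of_comp_eq ha,
          ← comp_assoc _ _ (TensorProduct.assoc R A A A).toLinearMap,
          ← act_comp_of_comp_eq ha]
        rfl
      _ = _ := by
        rw [mulAg_eq_mul_comp_act]
        simp only [comp_assoc]
        rw [← comp_assoc _ (map LinearMap.id (act _ _)), ← map_comp, LinearMap.id_comp]
  · have e : (TensorProduct.rid R A).toLinearMap ∘ₗ map (mul' R A) γ' ∘ₗ
          (tensorTensorTensorComm R A H A H).toLinearMap ∘ₗ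
            (TensorProduct.mk R (A ⊗[R] H) (A ⊗[R] H)).flip (1 ⊗ₜ 1) =
        (TensorProduct.rid R A).toLinearMap ∘ₗ map LinearMap.id (counit (R := R)) := by
      ext; simp [hco.inv_unital_right]
    calc mulAg R H A δ γ' (a ⊗ₜ 1)
      _ = ((TensorProduct.rid R A).toLinearMap ∘ₗ map (mul' R A) γ' ∘ₗ
          (tensorTensorTensorComm R A H A H).toLinearMap) (δ a ⊗ₜ δ 1) := rfl
      _ = a := by
        rw [hδ.2.2]
        exact congr($e (δ a)).trans congr($hδ.isCounital a)
  · have e : (TensorProduct.rid R A).toLinearMap ∘ₗ map (mul' R A) γ' ∘ₗ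
          (tensorTensorTensorComm R A H A H).toLinearMap ∘ₗ
            TensorProduct.mk R (A ⊗[R] H) (A ⊗[R] H) (1 ⊗ₜ 1) =
        (TensorProduct.rid R A).toLinearMap ∘ₗ map LinearMap.id (counit (R := R)) := by
      ext; simp [hco.inv_unital_left]
    calc mulAg R H A δ γ' (1 ⊗ₜ a)
      _ = ((TensorProduct.rid R A).toLinearMap ∘ₗ map (mul' R A) γ' ∘ₗ
          (tensorTensorTensorComm R A H A H).toLinearMap) (δ 1 ⊗ₜ δ a) := rfl
      _ = a := by
        rw [hδ.2.2]
        exact congr($e (δ a)).trans congr($hδ.isCounital a)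
  · have hinv : toConv (Algebra.linearMap R H ∘ₗ γ') * toConv (Algebra.linearMap R H ∘ₗ γ) = 1 := by
      have := algHom_comp_convMul_distrib (Algebra.ofId R H) (toConv γ') (toConv γ)
      rw [hco.inv_mul] at this
      exact (ofConv_injective this).symm
    calc δ ∘ₗ mulAg R H A δ γ'
      _ = map (mul' R A) LinearMap.id ∘ₗ map LinearMap.id (mulH R H) ∘ₗ tensor δ δ ∘ₗ
            act (tensor δ δ) γ' := by
        rw [mulAg_eq_mul_comp_act, ← comp_assoc, hδ.comp_mul, ← comp_assoc (tensor δ δ ∘ₗ _),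
          ← map_comp, LinearMap.id_comp, LinearMap.comp_id, comp_assoc]
      _ = map (mul' R A) LinearMap.id ∘ₗ map (act (tensor δ δ) γ')
            (twistMul R H (mulH R H) γ γ') ∘ₗ tensor δ δ := by
        rw [map_comp_act hγ, map_act_comp hγ, twistMul_eq_conv, toConv_ofConv, mul_assoc,
          ← mul_assoc, hinv, one_mul]
      _ = _ := by
        rw [← comp_assoc, ← map_comp, LinearMap.id_comp, ← mulAg_eq_mul_comp_act]
        rfl
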